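/- Assume the Bregman PDMM setup (see context) with the mirror-averaging optimality conditions, primal optimality conditions and dual updates holding at every iteration t ∈ ℕ, parameters satisfying 0 < γ < μσ and τ ≤ ρ(μσ − γ), initial dual variable ν^0 = 0, and a consensus point x* ∈ 𝒳 (x*_i = x* for all i). Let T ≥ 1 and define the ergodic average x̄_i^T = (1/T) Σ_{t=1}^T x_i^t. Then Σ_{i=1}^m f_i(x̄_i^T) − Σ_{i=1}^m f_i(x*) ≤ (1/T) (ρ Σ_{i=1}^m B_φ(x*, y_i^0) + Σ_{i=1}^m δ_i B_{φ_i}(x*, x_i^0)). -/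

import Mathlib

open scoped RealInnerProductSpace BigOperators

/-- The Bregman divergence `B_φ(u,v) = φ(u) − φ(v) − ⟨∇φ(v), u − v⟩`. -/
noncomputable def breg {n : ℕ} (φ : EuclideanSpace ℝ (Fin n) → ℝ)
    (u v : EuclideanSpace ℝ (Fin n)) : ℝ :=
  φ u - φ v - ⟪gradient φ v, u - v⟫

/-- The ℓ_p norm on ℝ^n: `‖w‖_p = (Σ_k |w_k|^p)^(1/p)`. -/
noncomputable def lpnorm {n : ℕ} (p : ℝ) (w : EuclideanSpace ℝ (Fin n)) : ℝ :=
  (∑ k, |w k| ^ p) ^ (1 / p)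

/-- The weighted sums `∑ j, P i j • z j`. -/
noncomputable def mix {m : ℕ} {E : Type*} [AddCommMonoid E] [Module ℝ E]
    (P : Matrix (Fin m) (Fin m) ℝ) (z : Fin m → E) (i : Fin m) : E :=
  ∑ j, P i j • z j

section Mix

variable {m : ℕ} {E : Type*} [NormedAddCommGroup E] [InnerProductSpace ℝ E]
  {P : Matrix (Fin m) (Fin m) ℝ}

lemma mix_sub (a b : Fin m → E) (i : Fin m) :
    mix P (fun k => a k - b k) i = mix P a i - mix P b i := by
  simp [mix, smul_sub]

lemma sum_inner_mix_comm (hP : P.IsSymm) (a b : Fin m → E) :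
    ∑ i, ⟪a i, mix P b i⟫ = ∑ i, ⟪mix P a i, b i⟫ := by
  simp only [mix, inner_sum, sum_inner, real_inner_smul_left, real_inner_smul_right]
  rw [Finset.sum_comm]
  refine Finset.sum_congr rfl fun i _ => Finset.sum_congr rfl fun j _ => ?_
  rw [hP.apply i j]

lemma sum_sum_mul_right_eq (hP : P.IsSymm) (hrow : ∀ i, ∑ j, P i j = 1) (c : Fin m → ℝ) :
    ∑ i, ∑ j, P i j * c j = ∑ j, c j := by
  rw [Finset.sum_comm]
  refine Finset.sum_congr rfl fun j _ => ?_
  rw [← Finset.sum_mul]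
  simp only [fun i => hP.apply j i, hrow, one_mul]

lemma sum_mul_norm_sub_sq (hrow : ∀ i, ∑ j, P i j = 1) (u : E) (z : Fin m → E) (i : Fin m) :
    ∑ j, P i j * ‖u - z j‖ ^ 2 =
      ‖u - mix P z i‖ ^ 2 - ‖mix P z i‖ ^ 2 + ∑ j, P i j * ‖z j‖ ^ 2 := by
  have h : ⟪u, mix P z i⟫ = ∑ j, P i j * ⟪u, z j⟫ := by
    simp [mix, inner_sum, real_inner_smul_right]
  have h1 : ∑ j, P i j * ‖u - z j‖ ^ 2 =
      (∑ j, P i j) * ‖u‖ ^ 2 - 2 * ∑ j, P i j * ⟪u, z j⟫ + ∑ j, P i j * ‖z j‖ ^ 2 := by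
    rw [Finset.sum_mul, Finset.mul_sum, ← Finset.sum_sub_distrib, ← Finset.sum_add_distrib]
    refine Finset.sum_congr rfl fun j _ => ?_
    rw [norm_sub_sq_real]
    ring
  rw [h1, hrow, norm_sub_sq_real u (mix P z i), h]
  ring

lemma sum_inner_mix_le (hP : P.IsSymm) (hnn : ∀ i j, 0 ≤ P i j) (hrow : ∀ i, ∑ j, P i j = 1)
    (b : Fin m → E) : ∑ i, ⟪b i, mix P b i⟫ ≤ ∑ i, ‖b i‖ ^ 2 := by
  have h0 : 0 ≤ ∑ i, ∑ j, P i j * ‖b i - b j‖ ^ 2 :=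
    Finset.sum_nonneg fun i _ => Finset.sum_nonneg fun j _ => mul_nonneg (hnn i j) (sq_nonneg _)
  simp only [fun i => sum_mul_norm_sub_sq hrow (b i) b i, Finset.sum_add_distrib,
    sum_sum_mul_right_eq hP hrow (fun j => ‖b j‖ ^ 2), Finset.sum_sub_distrib] at h0
  simp only [norm_sub_sq_real, Finset.sum_add_distrib, Finset.sum_sub_distrib,
    ← Finset.mul_sum] at h0
  linarith

end Mix

section Euclidean

variable {n m : ℕ} {P : Matrix (Fin m) (Fin m) ℝ}

lemma sum_inner_mix_nonneg (hpsd : P.PosSemidef) (z : Fin m → EuclideanSpace ℝ (Fin n)) :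
    0 ≤ ∑ i, ⟪z i, mix P z i⟫ := by
  have h : ∑ i, ⟪z i, mix P z i⟫ =
      ∑ k, star (fun i => z i k) ⬝ᵥ P.mulVec (fun i => z i k) := by
    simp only [dotProduct, Matrix.mulVec, mix, PiLp.inner_apply]
    rw [Finset.sum_comm]
    refine Finset.sum_congr rfl fun k _ => Finset.sum_congr rfl fun i _ => ?_
    simp [mul_comm]
  rw [h]
  exact Finset.sum_nonneg fun k _ => hpsd.dotProduct_mulVec_nonneg _

lemma sum_norm_mix_sq_le (hP : P.IsSymm) (hnn : ∀ i j, 0 ≤ P i j)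
    (hrow : ∀ i, ∑ j, P i j = 1) (hpsd : P.PosSemidef)
    (z : Fin m → EuclideanSpace ℝ (Fin n)) :
    ∑ i, ‖mix P z i‖ ^ 2 ≤ ∑ i, ⟪z i, mix P z i⟫ := by
  have h0 := sum_inner_mix_nonneg hpsd (fun k => z k - mix P z k)
  have h1 := sum_inner_mix_le hP hnn hrow (mix P z)
  have h2 := sum_inner_mix_comm hP z (mix P z)
  simp only [mix_sub, inner_sub_left, inner_sub_right, Finset.sum_sub_distrib,
    real_inner_self_eq_norm_sq] at h0 h2
  linarith

lemma sum_norm_sub_mix_sq_le (hP : P.IsSymm) (hnn : ∀ i j, 0 ≤ P i j)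
    (hrow : ∀ i, ∑ j, P i j = 1) (hpsd : P.PosSemidef)
    (y z : Fin m → EuclideanSpace ℝ (Fin n)) :
    ∑ i, ‖z i - mix P z i‖ ^ 2 ≤ ∑ i, ∑ j, P i j * ‖y i - z j‖ ^ 2 := by
  have h0 : 0 ≤ ∑ i, ‖y i - mix P z i‖ ^ 2 := Finset.sum_nonneg fun i _ => sq_nonneg _
  have h1 := sum_norm_mix_sq_le hP hnn hrow hpsd z
  simp only [fun i => sum_mul_norm_sub_sq hrow (y i) z i, Finset.sum_add_distrib,
    sum_sum_mul_right_eq hP hrow (fun j => ‖z j‖ ^ 2), Finset.sum_sub_distrib]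
  simp only [norm_sub_sq_real (z _), Finset.sum_add_distrib, Finset.sum_sub_distrib,
    ← Finset.mul_sum]
  linarith

lemma breg_three_point (φ : EuclideanSpace ℝ (Fin n) → ℝ) (a b c : EuclideanSpace ℝ (Fin n)) :
    ⟪gradient φ a - gradient φ b, a - c⟫ = breg φ c a + breg φ a b - breg φ c b := by
  simp only [breg, inner_sub_left, inner_sub_right]
  ring

lemma breg_nonneg {φ : EuclideanSpace ℝ (Fin n) → ℝ} (hd : Differentiable ℝ φ)
    (hc : ConvexOn ℝ Set.univ φ) (u v : EuclideanSpace ℝ (Fin n)) : 0 ≤ breg φ u v := by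
  have hline : HasDerivAt (φ ∘ AffineMap.lineMap v u) (fderiv ℝ φ v (u - v)) (0 : ℝ) := by
    have h1 : HasFDerivAt φ (fderiv ℝ φ v) (AffineMap.lineMap v u (0 : ℝ)) := by
      simpa using (hd v).hasFDerivAt
    exact h1.comp_hasDerivAt 0 AffineMap.hasDerivAt_lineMap
  have hconv : ConvexOn ℝ Set.univ (φ ∘ AffineMap.lineMap v u : ℝ → ℝ) :=
    hc.comp_affineMap (AffineMap.lineMap v u)
  have h := hconv.le_slope_of_hasDerivAt (Set.mem_univ 0) (Set.mem_univ 1) one_pos hline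
  simp only [slope_def_field, Function.comp_apply, AffineMap.lineMap_apply_one,
    AffineMap.lineMap_apply_zero, sub_zero, div_one] at h
  rw [breg, inner_gradient_left]
  linarith

lemma sum_rpow_le_rpow_sum {ι : Type*} (s : Finset ι) {a : ι → ℝ} (ha : ∀ i, 0 ≤ a i)
    {q : ℝ} (hq : 1 ≤ q) : ∑ i ∈ s, a i ^ q ≤ (∑ i ∈ s, a i) ^ q := by
  classical
  induction s using Finset.induction_on with
  | empty => simp [Real.zero_rpow (by linarith : q ≠ 0)]
  | insert i s his ih =>
    rw [Finset.sum_insert his, Finset.sum_insert his]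
    have h := Real.add_rpow_le_rpow_add (ha i) (Finset.sum_nonneg fun j (_ : j ∈ s) => ha j) hq
    linarith

/-- Comparison of the Euclidean norm with the `ℓ_p` norm. -/
lemma min_mul_norm_sq_le_lpnorm_sq {p : ℝ} (hp : 1 ≤ p) (w : EuclideanSpace ℝ (Fin n)) :
    min 1 ((n : ℝ) ^ (2 / p - 1)) * ‖w‖ ^ 2 ≤ lpnorm p w ^ 2 := by
  have hp0 : 0 < p := by linarith
  have hS : 0 ≤ ∑ k, |w k| ^ p :=
    Finset.sum_nonneg fun k _ => Real.rpow_nonneg (abs_nonneg _) _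
  have hl : lpnorm p w ^ 2 = (∑ k, |w k| ^ p) ^ (2 / p) := by
    rw [lpnorm, ← Real.rpow_natCast, ← Real.rpow_mul hS]
    congr 1
    push_cast
    ring
  have hw : ‖w‖ ^ 2 = ∑ k, |w k| ^ 2 := by
    simp [EuclideanSpace.norm_sq_eq]
  rw [hl]
  rcases le_or_gt p 2 with h2 | h2
  · have h := sum_rpow_le_rpow_sum Finset.univ (a := fun k => |w k| ^ p)
      (fun k => Real.rpow_nonneg (abs_nonneg _) _) (q := 2 / p) ((one_le_div hp0).2 h2)
    have hk : ∀ k, (|w k| ^ p) ^ (2 / p) = |w k| ^ 2 := fun k => by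
      rw [← Real.rpow_mul (abs_nonneg _), mul_div_cancel₀ _ hp0.ne']
      norm_cast
    simp only [hk, ← hw] at h
    exact (mul_le_of_le_one_left (sq_nonneg _) (min_le_left _ _)).trans h
  · rcases Nat.eq_zero_or_pos n with rfl | hn
    · rw [hw]
      simpa using Real.rpow_nonneg le_rfl _
    have hn0 : (0 : ℝ) < n := by exact_mod_cast hn
    have h := Real.rpow_sum_le_const_mul_sum_rpow_of_nonneg (Finset.univ : Finset (Fin n))
      (f := fun k => |w k| ^ 2) (p := p / 2) (by linarith) (fun k _ => sq_nonneg _)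
    have hk : ∀ k, (|w k| ^ 2) ^ (p / 2) = |w k| ^ p := fun k => by
      rw [← Real.rpow_natCast, ← Real.rpow_mul (abs_nonneg _)]
      congr 1
      push_cast
      ring
    simp only [hk, ← hw, Finset.card_univ, Fintype.card_fin] at h
    have h' := Real.rpow_le_rpow (Real.rpow_nonneg (sq_nonneg _) _) h
      (div_nonneg zero_le_two hp0.le : 0 ≤ 2 / p)
    rw [Real.mul_rpow (Real.rpow_nonneg hn0.le _) hS, ← Real.rpow_mul (sq_nonneg _),
      ← Real.rpow_mul hn0.le, show p / 2 * (2 / p) = 1 by field_simp, Real.rpow_one,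
      show (p / 2 - 1) * (2 / p) = -(2 / p - 1) by field_simp; ring,
      Real.rpow_neg hn0.le] at h'
    have hpos : 0 < (n : ℝ) ^ (2 / p - 1) := Real.rpow_pos_of_pos hn0 _
    calc min 1 ((n : ℝ) ^ (2 / p - 1)) * ‖w‖ ^ 2
        ≤ (n : ℝ) ^ (2 / p - 1) * ‖w‖ ^ 2 :=
          mul_le_mul_of_nonneg_right (min_le_right _ _) (sq_nonneg _)
      _ ≤ _ := by
          have := mul_le_mul_of_nonneg_left h' hpos.le
          rwa [← mul_assoc, mul_inv_cancel₀ hpos.ne', one_mul] at this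

/-- The dual pairing in one step, written as a telescoping difference plus the residual. -/
lemma sum_inner_dual_step (hP : P.IsSymm) (hrow : ∀ i, ∑ j, P i j = 1) {τ : ℝ} (hτ : 0 < τ)
    {z ν ν' : Fin m → EuclideanSpace ℝ (Fin n)}
    (hdual : ∀ i, ν' i = ν i + τ • (z i - mix P z i)) (u : EuclideanSpace ℝ (Fin n)) :
    ∑ i, ⟪-ν i + mix P ν i, z i - u⟫ =
      1 / (2 * τ) * ∑ i, ‖ν i‖ ^ 2 - 1 / (2 * τ) * ∑ i, ‖ν' i‖ ^ 2
        + τ / 2 * ∑ i, ‖z i - mix P z i‖ ^ 2 := by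
  have hu : ∀ i, mix P (fun _ => u) i = u := fun i => by
    simp [mix, ← Finset.sum_smul, hrow]
  have h1 := sum_inner_mix_comm hP ν z
  have h2 := sum_inner_mix_comm hP ν (fun _ => u)
  simp only [hu] at h2
  have h3 : ∑ i, ⟪-ν i + mix P ν i, z i - u⟫ = -∑ i, ⟪ν i, z i - mix P z i⟫ := by
    simp only [inner_add_left, inner_neg_left, inner_sub_right, Finset.sum_add_distrib,
      Finset.sum_neg_distrib, Finset.sum_sub_distrib]
    linarith
  have h4 : ∑ i, ‖ν' i‖ ^ 2 = ∑ i, ‖ν i‖ ^ 2 + 2 * τ * ∑ i, ⟪ν i, z i - mix P z i⟫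
      + τ ^ 2 * ∑ i, ‖z i - mix P z i‖ ^ 2 := by
    simp only [Finset.mul_sum, ← Finset.sum_add_distrib]
    refine Finset.sum_congr rfl fun i _ => ?_
    rw [hdual i, norm_add_sq_real, real_inner_smul_right, norm_smul, mul_pow, Real.norm_eq_abs,
      sq_abs]
    ring
  rw [h3, h4]
  field_simp
  ring

/-- Mirror averaging decreases the total divergence from a feasible point. -/
lemma sum_breg_mirror_le (hP : P.IsSymm) (hrow : ∀ i, ∑ j, P i j = 1)
    {φ : EuclideanSpace ℝ (Fin n) → ℝ} {y z : Fin m → EuclideanSpace ℝ (Fin n)}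
    {u : EuclideanSpace ℝ (Fin n)}
    (hmirror : ∀ i, 0 ≤ ∑ j, P i j * ⟪gradient φ (y i) - gradient φ (z j), u - y i⟫) :
    ∑ i, breg φ u (y i) + ∑ i, ∑ j, P i j * breg φ (y i) (z j) ≤ ∑ i, breg φ u (z i) := by
  rw [← sum_sum_mul_right_eq hP hrow (fun j => breg φ u (z j)), ← Finset.sum_add_distrib]
  refine Finset.sum_le_sum fun i _ => ?_
  have h := hmirror i
  have hj : ∀ j, ⟪gradient φ (y i) - gradient φ (z j), u - y i⟫ =
      breg φ u (z j) - breg φ u (y i) - breg φ (y i) (z j) := fun j => by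
    rw [← neg_sub (y i) u, inner_neg_right, breg_three_point]
    ring
  simp only [hj, mul_sub, Finset.sum_sub_distrib, ← Finset.sum_mul, hrow, one_mul] at h
  linarith

end Euclidean

/-- `O(1/T)` ergodic convergence of the objective values for Bregman PDMM. -/
theorem bregman_pdmm_ergodic_objective_rate {n m : ℕ}
    (𝒳 : Set (EuclideanSpace ℝ (Fin n)))
    (hXne : 𝒳.Nonempty) (hXclosed : IsClosed 𝒳) (hXconv : Convex ℝ 𝒳)
    (f : Fin m → EuclideanSpace ℝ (Fin n) → ℝ)
    (hf : ∀ i, ConvexOn ℝ Set.univ (f i))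
    (P : Matrix (Fin m) (Fin m) ℝ) (hPsym : P.IsSymm)
    (hPnn : ∀ i j, 0 ≤ P i j) (hProw : ∀ i, ∑ j, P i j = 1) (hPpsd : P.PosSemidef)
    (φ : EuclideanSpace ℝ (Fin n) → ℝ)
    (hφd : Differentiable ℝ φ) (hφc : ConvexOn ℝ Set.univ φ)
    (φi : Fin m → EuclideanSpace ℝ (Fin n) → ℝ)
    (hφid : ∀ i, Differentiable ℝ (φi i)) (hφic : ∀ i, ConvexOn ℝ Set.univ (φi i))
    (μ p σ ρ τ γ : ℝ) (δ : Fin m → ℝ)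
    (hμ : 0 < μ) (hp : 1 ≤ p)
    (hstrong : ∀ u ∈ 𝒳, ∀ v ∈ 𝒳, μ / 2 * lpnorm p (u - v) ^ 2 ≤ breg φ u v)
    (hσ : σ = min 1 ((n : ℝ) ^ (2 / p - 1)))
    (hρ : 0 < ρ) (hτ : 0 < τ) (hδ : ∀ i, 0 ≤ δ i)
    (hγ0 : 0 < γ) (hγ : γ < μ * σ) (hτρ : τ ≤ ρ * (μ * σ - γ))
    (x y ν : ℕ → Fin m → EuclideanSpace ℝ (Fin n))
    (hxX : ∀ t i, x t i ∈ 𝒳) (hyX : ∀ t i, y t i ∈ 𝒳)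
    (hmirror : ∀ t : ℕ, ∀ i, ∀ u ∈ 𝒳,
      0 ≤ ∑ j, P i j * ⟪gradient φ (y t i) - gradient φ (x t j), u - y t i⟫)
    (hprimal : ∀ t : ℕ, ∀ i, ∃ g : EuclideanSpace ℝ (Fin n),
      (∀ v ∈ 𝒳, 0 ≤ ⟪g, x (t + 1) i - v⟫) ∧
      ∀ v, f i v ≥ f i (x (t + 1) i) +
        ⟪-ν t i + (∑ j, P i j • ν t j)
            - ρ • (gradient φ (x (t + 1) i) - gradient φ (y t i))
            - δ i • (gradient (φi i) (x (t + 1) i) - gradient (φi i) (x t i))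
            - g, v - x (t + 1) i⟫)
    (hdual : ∀ t : ℕ, ∀ i, ν (t + 1) i =
      ν t i + τ • (x (t + 1) i - ∑ j, P i j • x (t + 1) j))
    (hν0 : ∀ i, ν 0 i = 0)
    (xstar : EuclideanSpace ℝ (Fin n)) (hxstar : xstar ∈ 𝒳)
    (T : ℕ) (hT : 1 ≤ T)
    (xbar : Fin m → EuclideanSpace ℝ (Fin n))
    (hxbar : ∀ i, xbar i = (1 / (T : ℝ)) • ∑ t ∈ Finset.Icc 1 T, x t i) :
    (∑ i, f i (xbar i)) - ∑ i, f i xstar ≤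
      (1 / (T : ℝ)) *
        (ρ * (∑ i, breg φ xstar (y 0 i)) +
          ∑ i, δ i * breg (φi i) xstar (x 0 i)) := by
  set V : ℕ → ℝ := fun t => 1 / (2 * τ) * ∑ i, ‖ν t i‖ ^ 2 + ρ * (∑ i, breg φ xstar (y t i)) +
    ∑ i, δ i * breg (φi i) xstar (x t i) with hV
  have hstep : ∀ t, ∑ i, f i (x (t + 1) i) - ∑ i, f i xstar ≤ V t - V (t + 1) := by
    intro t
    have hpt : ∀ i, f i (x (t + 1) i) - f i xstar ≤
        ⟪-ν t i + mix P (ν t) i, x (t + 1) i - xstar⟫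
          - ρ * (breg φ xstar (x (t + 1) i) - breg φ xstar (y t i))
          - (δ i * breg (φi i) xstar (x (t + 1) i) - δ i * breg (φi i) xstar (x t i)) := by
      intro i
      obtain ⟨g, hg, hsub⟩ := hprimal t i
      have h := hsub xstar
      rw [← neg_sub (x (t + 1) i) xstar, inner_neg_right, inner_sub_left, inner_sub_left,
        inner_sub_left, real_inner_smul_left, real_inner_smul_left, breg_three_point,
        breg_three_point] at h
      have h1 := hg xstar hxstar
      have h2 := mul_nonneg hρ.le (breg_nonneg hφd hφc (x (t + 1) i) (y t i))
      have h3 := mul_nonneg (hδ i) (breg_nonneg (hφid i) (hφic i) (x (t + 1) i) (x t i))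
      simp only [mix]
      linarith
    have hsum := Finset.sum_le_sum fun i (_ : i ∈ Finset.univ) => hpt i
    simp only [Finset.sum_sub_distrib, ← Finset.mul_sum] at hsum
    rw [sum_inner_dual_step hPsym hProw hτ (hdual t) xstar] at hsum
    have hmir := mul_le_mul_of_nonneg_left
      (sum_breg_mirror_le hPsym hProw fun i => hmirror (t + 1) i xstar hxstar) hρ.le
    have hres : τ / 2 * ∑ i, ‖x (t + 1) i - mix P (x (t + 1)) i‖ ^ 2 ≤
        ρ * ∑ i, ∑ j, P i j * breg φ (y (t + 1) i) (x (t + 1) j) := by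
      calc τ / 2 * ∑ i, ‖x (t + 1) i - mix P (x (t + 1)) i‖ ^ 2
          ≤ ρ * (μ / 2 * σ) * ∑ i, ∑ j, P i j * ‖y (t + 1) i - x (t + 1) j‖ ^ 2 := by
            refine mul_le_mul ?_ (sum_norm_sub_mix_sq_le hPsym hPnn hProw hPpsd _ _)
              (Finset.sum_nonneg fun i _ => sq_nonneg _) ?_
            · nlinarith [mul_pos hρ hγ0]
            · nlinarith [mul_pos hρ hγ0]
        _ ≤ _ := by
            rw [mul_assoc, Finset.mul_sum]
            refine mul_le_mul_of_nonneg_left (Finset.sum_le_sum fun i _ => ?_) hρ.le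
            rw [Finset.mul_sum]
            refine Finset.sum_le_sum fun j _ => ?_
            rw [mul_left_comm]
            refine mul_le_mul_of_nonneg_left ?_ (hPnn i j)
            refine le_trans ?_ (hstrong _ (hyX (t + 1) i) _ (hxX (t + 1) j))
            rw [mul_assoc, hσ]
            exact mul_le_mul_of_nonneg_left (min_mul_norm_sq_le_lpnorm_sq hp _) (by linarith)
    simp only [hV]
    linarith
  have htel : ∀ N : ℕ, ∑ t ∈ Finset.range N, (∑ i, f i (x (t + 1) i) - ∑ i, f i xstar) ≤
      V 0 - V N := fun N =>
    (Finset.sum_le_sum fun t _ => hstep t).trans_eq (Finset.sum_range_sub' V N)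
  have hVT : 0 ≤ V T := by
    have h1 : 0 ≤ ∑ i, ‖ν T i‖ ^ 2 := Finset.sum_nonneg fun i _ => sq_nonneg _
    have h2 : 0 ≤ ∑ i, breg φ xstar (y T i) := Finset.sum_nonneg fun i _ => breg_nonneg hφd hφc _ _
    have h3 : 0 ≤ ∑ i, δ i * breg (φi i) xstar (x T i) :=
      Finset.sum_nonneg fun i _ => mul_nonneg (hδ i) (breg_nonneg (hφid i) (hφic i) _ _)
    simp only [hV]
    positivity
  have hV0 : V 0 = ρ * (∑ i, breg φ xstar (y 0 i)) +
      ∑ i, δ i * breg (φi i) xstar (x 0 i) := by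
    simp [hV, hν0]
  have hT0 : (0 : ℝ) < T := by exact_mod_cast hT
  have hIcc : ∀ {M : Type} [AddCommMonoid M] (a : ℕ → M),
      ∑ t ∈ Finset.Icc 1 T, a t = ∑ t ∈ Finset.range T, a (t + 1) := fun a => by
    rw [Finset.range_eq_Ico, Finset.sum_Ico_add' a 0 T 1]
    rfl
  have hjensen : ∀ i, f i (xbar i) ≤ 1 / (T : ℝ) * ∑ t ∈ Finset.range T, f i (x (t + 1) i) := by
    intro i
    have h := (hf i).map_sum_le (t := Finset.range T) (w := fun _ => 1 / (T : ℝ))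
      (p := fun t => x (t + 1) i) (fun _ _ => by positivity)
      (by simp [hT0.ne']) (fun _ _ => Set.mem_univ _)
    rw [hxbar i, hIcc, Finset.smul_sum, Finset.mul_sum]
    simpa only [smul_eq_mul] using h
  have hfin := htel T
  rw [Finset.sum_sub_distrib, Finset.sum_const, Finset.card_range, nsmul_eq_mul,
    Finset.sum_comm] at hfin
  rw [← hV0]
  calc (∑ i, f i (xbar i)) - ∑ i, f i xstar
      ≤ (∑ i, 1 / (T : ℝ) * ∑ t ∈ Finset.range T, f i (x (t + 1) i)) - ∑ i, f i xstar :=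
        sub_le_sub_right (Finset.sum_le_sum fun i _ => hjensen i) _
    _ = 1 / (T : ℝ) * (∑ i, ∑ t ∈ Finset.range T, f i (x (t + 1) i) - T * ∑ i, f i xstar) := by
        rw [← Finset.mul_sum]
        field_simp
    _ ≤ 1 / (T : ℝ) * V 0 := mul_le_mul_of_nonneg_left (by linarith) (by positivity)
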